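/- arXiv:1811.06205 — 3 statements merged into one kernel-verified Lean document; each statement's English description precedes it below -/
import Mathlib

section
/- Let G be a finite pseudoreflection subgroup of GL(n,ℂ), d = |G|, let p₁,…,p_d be a basis of ℂ[z] as a module over ℂ[z]^G, and let Ω ⊆ ℂⁿ be a G-invariant domain. Then for every holomorphic function f : Ω → ℂ there exist unique G-invariant holomorphic functions f₁,…,f_d : Ω → ℂ such that f(z) = Σᵢ₌₁^d pᵢ(z)fᵢ(z) for all z ∈ Ω. (In other words, the ring O(Ω) of holomorphic functions on Ω is a free module of rank |G| over the subring O(Ω)^G of G-invariant holomorphic functions, with basis p₁,…,p_d.) -/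
open MvPolynomial

noncomputable section

/-- The natural action of an invertible matrix on `ℂⁿ` by matrix-vector multiplication. -/
def gAct {n : ℕ} (σ : GL (Fin n) ℂ) (z : Fin n → ℂ) : Fin n → ℂ :=
  Matrix.mulVec (σ : Matrix (Fin n) (Fin n) ℂ) z

/-- A pseudoreflection: an element of finite order in `GL(n,ℂ)` with `rank (1 - ρ) = 1`. -/
def IsPseudoreflection {n : ℕ} (ρ : GL (Fin n) ℂ) : Prop :=
  IsOfFinOrder ρ ∧ Matrix.rank ((1 : Matrix (Fin n) (Fin n) ℂ) - (ρ : Matrix (Fin n) (Fin n) ℂ)) = 1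

/-- A subgroup of `GL(n,ℂ)` is a pseudoreflection group if it is generated by the
pseudoreflections it contains. -/
def IsPseudoreflectionGroup {n : ℕ} (G : Subgroup (GL (Fin n) ℂ)) : Prop :=
  Subgroup.closure {ρ : GL (Fin n) ℂ | ρ ∈ G ∧ IsPseudoreflection ρ} = G

/-- The action of `σ ∈ GL(n,ℂ)` on polynomials: `(σ·p)(z) = p(σ⁻¹z)`. -/
def polyAct {n : ℕ} (σ : GL (Fin n) ℂ) (p : MvPolynomial (Fin n) ℂ) : MvPolynomial (Fin n) ℂ :=
  MvPolynomial.aeval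
    (fun i => ∑ j, MvPolynomial.C (((σ⁻¹ : GL (Fin n) ℂ) : Matrix (Fin n) (Fin n) ℂ) i j)
      * MvPolynomial.X j) p

/-- The polynomial map `θ : ℂⁿ → ℂⁿ` associated to a tuple of polynomials. -/
def polyMap {n : ℕ} (θ : Fin n → MvPolynomial (Fin n) ℂ) (z : Fin n → ℂ) : Fin n → ℂ :=
  fun i => MvPolynomial.eval z (θ i)

theorem differentiableAt_circleIntegral_mul_line {E : Type*} [NormedAddCommGroup E]
    [NormedSpace ℂ E] [FiniteDimensional ℂ E] {f : E → ℂ} {U : Set E} (hU : IsOpen U)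
    (hf : DifferentiableOn ℂ f U) {c : ℂ → ℂ} {r : ℝ} (hr : 0 ≤ r)
    (hc : ContinuousOn c (Metric.sphere 0 r)) {z v : E}
    (hz : ∀ t ∈ Metric.sphere (0 : ℂ) r, z + t • v ∈ U) :
    DifferentiableAt ℂ (fun x => ∮ t in C(0, r), c t * f (x + t • v)) z := by
  have : ProperSpace E := FiniteDimensional.proper ℂ E
  have : ProperSpace (E →L[ℂ] ℂ) := FiniteDimensional.proper ℂ _
  borelize E
  borelize (E →L[ℂ] ℂ)
  set S : Set E := (fun t : ℂ => z + t • v) '' Metric.sphere 0 r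
  have hScomp : IsCompact S := (isCompact_sphere _ _).image (by fun_prop)
  have hSU : S ⊆ U := by
    rintro _ ⟨t, ht, rfl⟩
    exact hz t ht
  obtain ⟨δ, hδ, hδU⟩ := hScomp.exists_cthickening_subset_open hU hSU
  obtain ⟨M, hM⟩ := (hScomp.cthickening (r := δ)).exists_bound_of_continuousOn
    (hf.continuousOn.mono hδU)
  obtain ⟨C, hC⟩ := (isCompact_sphere (0 : ℂ) r).exists_bound_of_continuousOn hc
  have hmem : ∀ θ : ℝ, circleMap 0 r θ ∈ Metric.sphere (0 : ℂ) r :=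
    fun θ => circleMap_mem_sphere 0 hr θ
  have hthick : ∀ x ∈ Metric.ball z (δ / 2), ∀ θ : ℝ, ∀ y ∈ Metric.ball (x + circleMap 0 r θ • v)
      (δ / 2), y ∈ Metric.cthickening δ S := by
    intro x hx θ y hy
    refine Metric.mem_cthickening_of_dist_le y (z + circleMap 0 r θ • v) δ S ⟨_, hmem θ, rfl⟩ ?_
    have h1 := dist_triangle y (x + circleMap 0 r θ • v) (z + circleMap 0 r θ • v)
    rw [dist_add_right] at h1
    rw [Metric.mem_ball] at hx hy
    linarith
  have hself : ∀ x ∈ Metric.ball z (δ / 2), ∀ θ : ℝ,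
      x + circleMap 0 r θ • v ∈ Metric.cthickening δ S :=
    fun x hx θ => hthick x hx θ _ (Metric.mem_ball_self (by positivity))
  have hcont : ∀ x ∈ Metric.ball z (δ / 2), Continuous fun θ : ℝ =>
      deriv (circleMap 0 r) θ • (c (circleMap 0 r θ) * f (x + circleMap 0 r θ • v)) := by
    intro x hx
    have h1 : Continuous fun θ : ℝ => c (circleMap 0 r θ) :=
      hc.comp_continuous (continuous_circleMap 0 r) hmem
    have h2 : Continuous fun θ : ℝ => f (x + circleMap 0 r θ • v) :=
      hf.continuousOn.comp_continuous (by fun_prop) fun θ => hδU (hself x hx θ)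
    simp only [deriv_circleMap]
    exact ((continuous_circleMap 0 r).mul continuous_const).smul (h1.mul h2)
  have key := intervalIntegral.hasFDerivAt_integral_of_dominated_of_fderiv_le
    (𝕜 := ℂ) (μ := MeasureTheory.volume) (a := 0) (b := 2 * Real.pi)
    (bound := fun _ => r * C * (2 * M / (δ / 2)))
    (F := fun x θ => deriv (circleMap 0 r) θ • (c (circleMap 0 r θ) * f (x + circleMap 0 r θ • v)))
    (F' := fun x θ => deriv (circleMap 0 r) θ •
      (c (circleMap 0 r θ) • fderiv ℂ f (x + circleMap 0 r θ • v)))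
    (Metric.ball_mem_nhds z (show 0 < δ / 2 by positivity)) ?_ ?_ ?_ ?_ ?_ ?_
  · exact key.differentiableAt
  · filter_upwards [Metric.ball_mem_nhds z (show 0 < δ / 2 by positivity)] with x hx
    exact (hcont x hx).aestronglyMeasurable
  · exact (hcont z (Metric.mem_ball_self (by positivity))).intervalIntegrable _ _
  · have h1 : Continuous fun θ : ℝ => c (circleMap 0 r θ) :=
      hc.comp_continuous (continuous_circleMap 0 r) hmem
    have h2 : Continuous fun θ : ℝ => z + circleMap 0 r θ • v := by fun_prop
    have h3 : Measurable fun θ : ℝ => fderiv ℂ f (z + circleMap 0 r θ • v) :=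
      (measurable_fderiv ℂ f).comp h2.measurable
    have h4 : Continuous fun θ : ℝ => deriv (circleMap 0 r) θ := by
      simp only [deriv_circleMap]
      fun_prop
    exact h4.aestronglyMeasurable.smul (h1.aestronglyMeasurable.smul
      h3.stronglyMeasurable.aestronglyMeasurable)
  · refine Filter.Eventually.of_forall fun θ _ x hx => ?_
    have h1 : ‖fderiv ℂ f (x + circleMap 0 r θ • v)‖ ≤ 2 * M / (δ / 2) := by
      refine Complex.norm_fderiv_le_div_of_mapsTo_ball
        (hf.mono fun y hy => hδU (hthick x hx θ y hy)) (fun y hy => ?_) (by positivity)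
      rw [Metric.mem_closedBall, dist_eq_norm]
      have h2 := hM _ (hthick x hx θ y hy)
      have h3 := hM _ (hself x hx θ)
      exact (norm_sub_le _ _).trans (by linarith)
    have h2 : ‖deriv (circleMap 0 r) θ‖ = r := by simp [deriv_circleMap, abs_of_nonneg hr]
    have h3 := hC _ (hmem θ)
    rw [norm_smul, norm_smul, h2, mul_assoc]
    have h4 : 0 ≤ C := (norm_nonneg _).trans h3
    gcongr
  · exact intervalIntegrable_const
  · refine Filter.Eventually.of_forall fun θ _ x hx => ?_
    have h1 : HasFDerivAt f (fderiv ℂ f (x + circleMap 0 r θ • v)) (x + circleMap 0 r θ • v) :=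
      (hf.differentiableAt (hU.mem_nhds (hδU (hself x hx θ)))).hasFDerivAt
    have h2 : HasFDerivAt (fun y => f (y + circleMap 0 r θ • v))
        (fderiv ℂ f (x + circleMap 0 r θ • v)) x := by
      rwa [hasFDerivAt_comp_add_right]
    exact (h2.const_mul _).fun_const_smul _

theorem DifferentiableOn.lineDeriv_differentiableOn {E : Type*} [NormedAddCommGroup E]
    [NormedSpace ℂ E] [FiniteDimensional ℂ E] {f : E → ℂ} {U : Set E} (hU : IsOpen U)
    (hf : DifferentiableOn ℂ f U) (v : E) :
    DifferentiableOn ℂ (fun z => fderiv ℂ f z v) U := by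
  intro z hz
  have hline : ∀ᶠ p : E × ℂ in nhds (z, 0), p.1 + p.2 • v ∈ U := by
    have : Continuous fun p : E × ℂ => p.1 + p.2 • v := by fun_prop
    exact this.continuousAt.eventually (hU.mem_nhds (by simpa using hz))
  rw [nhds_prod_eq, Filter.eventually_prod_iff] at hline
  obtain ⟨P, hP, Q, hQ, hPQ⟩ := hline
  obtain ⟨r, hr, hrQ⟩ := Metric.eventually_nhds_iff_ball.1 hQ
  have hmem : ∀ x, P x → ∀ t ∈ Metric.closedBall (0 : ℂ) (r / 2), x + t • v ∈ U := fun x hx t ht =>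
    hPQ hx (hrQ t (Metric.closedBall_subset_ball (by linarith) ht))
  have hkey := differentiableAt_circleIntegral_mul_line hU hf (c := fun t => 1 / (t - 0) ^ 2)
    (r := r / 2) (z := z) (v := v) (by positivity) ?_ fun t ht =>
      hmem z hP.self_of_nhds t (Metric.sphere_subset_closedBall ht)
  · refine DifferentiableAt.differentiableWithinAt ?_
    refine (hkey.const_mul (2 * Real.pi * Complex.I)⁻¹).congr_of_eventuallyEq ?_
    filter_upwards [hP] with x hx
    have hd : ∀ t ∈ Metric.closedBall (0 : ℂ) (r / 2),
        HasDerivAt (fun t : ℂ => f (x + t • v)) (fderiv ℂ f (x + t • v) v) t := by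
      intro t ht
      have h1 := (hf.differentiableAt (hU.mem_nhds (hmem x hx t ht))).hasFDerivAt
      have h2 : HasDerivAt (fun t : ℂ => x + t • v) v t := by
        simpa using ((hasDerivAt_id t).smul_const v).const_add x
      exact h1.comp_hasDerivAt t h2
    have hdiff : DiffContOnCl ℂ (fun t : ℂ => f (x + t • v)) (Metric.ball 0 (r / 2)) := by
      refine DifferentiableOn.diffContOnCl fun t ht => ?_
      have ht' := Metric.closure_ball_subset_closedBall ht
      exact (hd t ht').differentiableAt.differentiableWithinAt
    have h := hdiff.deriv_eq_smul_circleIntegral (by positivity)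
    have h0 := (hd 0 (Metric.mem_closedBall_self (by positivity))).deriv
    simp only [smul_eq_mul, zero_smul, add_zero] at h h0
    rw [h, h0, inv_mul_cancel_left₀ Complex.two_pi_I_ne_zero]
  · intro t ht
    have : t ≠ 0 := Metric.ne_of_mem_sphere ht (by positivity)
    have h2 : (t - 0) ^ 2 ≠ 0 := by simpa using this
    exact ContinuousAt.continuousWithinAt (by fun_prop (disch := assumption))

theorem eval_aeval_eq {σ τ R : Type*} [CommRing R] (g : σ → MvPolynomial τ R) (z : τ → R)
    (q : MvPolynomial σ R) :
    MvPolynomial.eval z (MvPolynomial.aeval g q) =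
      MvPolynomial.eval (fun i => MvPolynomial.eval z (g i)) q := by
  induction q using MvPolynomial.induction_on with
  | C a => simp
  | add p q hp hq => simp only [map_add, hp, hq]
  | mul_X p i hp => simp only [map_mul, aeval_X, eval_X, hp]

theorem exists_eval_eq_iteratedDeriv_line {n : ℕ} (k : ℕ) {f : (Fin n → ℂ) → ℂ}
    {U : Set (Fin n → ℂ)} (hU : IsOpen U) (hf : DifferentiableOn ℂ f U) {w : Fin n → ℂ}
    (hw : w ∈ U) :
    ∃ P : MvPolynomial (Fin n) ℂ, ∀ z,
      iteratedDeriv k (fun t : ℂ => f (w + t • z)) 0 = MvPolynomial.eval z P := by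
  induction k generalizing f with
  | zero => exact ⟨C (f w), fun z => by simp⟩
  | succ k ih =>
    have hpartial := fun i : Fin n => hf.lineDeriv_differentiableOn hU (Pi.single i 1)
    choose P hP using fun i => ih (hpartial i)
    refine ⟨∑ i, X i * P i, fun z => ?_⟩
    have hmem : ∀ᶠ t : ℂ in nhds 0, w + t • z ∈ U := by
      have : Continuous fun t : ℂ => w + t • z := by fun_prop
      exact this.continuousAt.eventually (hU.mem_nhds (by simpa using hw))
    have hlin : ∀ t : ℂ, HasDerivAt (fun t : ℂ => w + t • z) z t := fun t => by
      simpa using ((hasDerivAt_id t).smul_const z).const_add w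
    have hderiv : deriv (fun t : ℂ => f (w + t • z)) =ᶠ[nhds 0]
        fun t => ∑ i, z i * fderiv ℂ f (w + t • z) (Pi.single i 1) := by
      filter_upwards [hmem] with t ht
      have h1 := (hf.differentiableAt (hU.mem_nhds ht)).hasFDerivAt
      refine (h1.comp_hasDerivAt t (hlin t)).deriv.trans ?_
      have h2 := congrArg (fderiv ℂ f (w + t • z)) (pi_eq_sum_univ' z)
      simpa only [map_sum, map_smul, smul_eq_mul] using h2
    rw [iteratedDeriv_succ', hderiv.iteratedDeriv_eq, iteratedDeriv_fun_sum]
    · simp only [iteratedDeriv_const_mul_field, hP, map_sum, map_mul, eval_X]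
    · intro i _
      have hd : ∀ᶠ t : ℂ in nhds 0, DifferentiableAt ℂ
          (fun t : ℂ => fderiv ℂ f (w + t • z) (Pi.single i 1)) t := by
        filter_upwards [hmem] with t ht
        exact ((hpartial i).differentiableAt (hU.mem_nhds ht)).comp t (hlin t).differentiableAt
      exact contDiffAt_const.mul
        (Complex.analyticAt_iff_eventually_differentiableAt.2 hd).contDiffAt

theorem exists_polynomial_approx_ball {n : ℕ} {f : (Fin n → ℂ) → ℂ} {U : Set (Fin n → ℂ)}
    (hU : IsOpen U) (hf : DifferentiableOn ℂ f U) {w : Fin n → ℂ} (hw : w ∈ U) :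
    ∃ ρ > 0, Metric.ball w ρ ⊆ U ∧ ∀ ε > 0, ∃ P : MvPolynomial (Fin n) ℂ,
      ∀ z ∈ Metric.ball w ρ, ‖MvPolynomial.eval z P - f z‖ ≤ ε := by
  obtain ⟨R, hR, hRU⟩ := Metric.nhds_basis_closedBall.mem_iff.1 (hU.mem_nhds hw)
  obtain ⟨M, hM⟩ := (isCompact_closedBall w R).exists_bound_of_continuousOn
    (hf.continuousOn.mono hRU)
  have hseg : ∀ z ∈ Metric.ball w (R / 2), ∀ t ∈ Metric.closedBall (0 : ℂ) 2,
      w + t • (z - w) ∈ Metric.closedBall w R := by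
    intro z hz t ht
    rw [mem_closedBall_iff_norm, add_sub_cancel_left, norm_smul]
    rw [mem_ball_iff_norm] at hz
    rw [mem_closedBall_zero_iff] at ht
    calc ‖t‖ * ‖z - w‖ ≤ 2 * (R / 2) := by gcongr
      _ = R := by ring
  refine ⟨R / 2, by positivity, fun z hz => hRU (Metric.ball_subset_closedBall
    (Metric.ball_subset_ball (by linarith) hz)), fun ε hε => ?_⟩
  choose P hP using fun k => exists_eval_eq_iteratedDeriv_line k hU hf hw
  let a : ℕ → (Fin n → ℂ) → ℂ := fun k z =>
    (k.factorial : ℂ)⁻¹ * MvPolynomial.eval (z - w) (P k)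
  have hdiff : ∀ z ∈ Metric.ball w (R / 2),
      DifferentiableOn ℂ (fun t : ℂ => f (w + t • (z - w))) (Metric.closedBall 0 2) := by
    intro z hz t ht
    have h1 := hf.differentiableAt (hU.mem_nhds (hRU (hseg z hz t ht)))
    exact (h1.comp t (by fun_prop)).differentiableWithinAt
  have hsum : ∀ z ∈ Metric.ball w (R / 2), HasSum (fun k => a k z) (f z) := by
    intro z hz
    have h := Complex.hasSum_taylorSeries_on_ball
      ((hdiff z hz).mono Metric.ball_subset_closedBall) (z := 1) (by simp)
    simpa [a, hP] using h
  have hbound : ∀ k, ∀ z ∈ Metric.ball w (R / 2), ‖a k z‖ ≤ M * (1 / 2) ^ k := by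
    intro k z hz
    have h := Complex.norm_iteratedDeriv_le_of_forall_mem_sphere_norm_le k (by norm_num)
      (DifferentiableOn.diffContOnCl ((hdiff z hz).mono
        Metric.closure_ball_subset_closedBall)) (C := M) fun t ht =>
        hM _ (hseg z hz t (Metric.sphere_subset_closedBall ht))
    rw [hP] at h
    have hk : (0 : ℝ) < k.factorial := by exact_mod_cast k.factorial_pos
    calc ‖a k z‖ = (k.factorial : ℝ)⁻¹ * ‖MvPolynomial.eval (z - w) (P k)‖ := by simp [a]
      _ ≤ (k.factorial : ℝ)⁻¹ * (k.factorial * M / 2 ^ k) := by gcongr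
      _ = M * (1 / 2) ^ k := by
        rw [one_div, inv_pow]
        field_simp
  have hunif := tendstoUniformlyOn_tsum_nat
    ((summable_geometric_of_lt_one (by norm_num) (by norm_num : (1 / 2 : ℝ) < 1)).mul_left M) hbound
  obtain ⟨N, hN⟩ := (Metric.tendstoUniformlyOn_iff.1 hunif ε hε).exists
  refine ⟨∑ k ∈ Finset.range N, C (k.factorial : ℂ)⁻¹ *
    MvPolynomial.aeval (fun i => X i - C (w i)) (P k), fun z hz => ?_⟩
  have h := hN z hz
  rw [(hsum z hz).tsum_eq, dist_comm, dist_eq_norm] at h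
  refine le_of_eq_of_le ?_ h.le
  congr 2
  rw [map_sum]
  refine Finset.sum_congr rfl fun k _ => ?_
  rw [map_mul, eval_C, eval_aeval_eq]
  simp only [a, map_sub, eval_X, eval_C]
  rfl

theorem exists_polynomial_near_zero_near_one {ε : ℝ} (hε : 0 < ε) :
    ∃ q : Polynomial ℂ, (∀ t : ℂ, ‖t‖ ≤ 1 / 4 → ‖q.eval t‖ ≤ ε) ∧
      ∀ t : ℂ, ‖t - 1‖ ≤ 1 / 4 → ‖q.eval t - 1‖ ≤ ε := by
  suffices h : ∀ k : ℕ, ∃ q : Polynomial ℂ,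
      (∀ t : ℂ, ‖t‖ ≤ 1 / 4 → ‖q.eval t‖ ≤ (7 / 8) ^ k * (1 / 4)) ∧
      ∀ t : ℂ, ‖t - 1‖ ≤ 1 / 4 → ‖q.eval t - 1‖ ≤ (7 / 8) ^ k * (1 / 4) by
    obtain ⟨k, hk⟩ := exists_pow_lt_of_lt_one hε (by norm_num : (7 / 8 : ℝ) < 1)
    obtain ⟨q, h0, h1⟩ := h k
    have hle : (7 / 8 : ℝ) ^ k * (1 / 4) ≤ ε := by
      have : (0 : ℝ) ≤ (7 / 8) ^ k := by positivity
      linarith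
    exact ⟨q, fun t ht => (h0 t ht).trans hle, fun t ht => (h1 t ht).trans hle⟩
  have hcontract : ∀ s : ℂ, ‖s‖ ≤ 1 / 4 → ‖3 * s ^ 2 - 2 * s ^ 3‖ ≤ 7 / 8 * ‖s‖ := by
    intro s hs
    have h3 : ‖3 - 2 * s‖ ≤ 7 / 2 := by
      refine (norm_sub_le _ _).trans ?_
      simp only [norm_mul, Complex.norm_ofNat]
      linarith
    calc ‖3 * s ^ 2 - 2 * s ^ 3‖ = ‖s‖ * ‖s‖ * ‖3 - 2 * s‖ := by
          rw [← norm_mul, ← norm_mul]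
          ring_nf
      _ ≤ 1 / 4 * ‖s‖ * (7 / 2) := by gcongr
      _ = 7 / 8 * ‖s‖ := by ring
  intro k
  induction k with
  | zero => exact ⟨Polynomial.X, by simp, by simp⟩
  | succ k ih =>
    obtain ⟨q, h0, h1⟩ := ih
    have hpow : (7 / 8 : ℝ) ^ k * (1 / 4) ≤ 1 / 4 := by
      have : (7 / 8 : ℝ) ^ k ≤ 1 := pow_le_one₀ (by norm_num) (by norm_num)
      linarith
    refine ⟨3 * q ^ 2 - 2 * q ^ 3, fun t ht => ?_, fun t ht => ?_⟩
    · have h := h0 t ht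
      have h2 := hcontract _ (h.trans hpow)
      simp only [Polynomial.eval_sub, Polynomial.eval_mul, Polynomial.eval_pow,
        Polynomial.eval_ofNat]
      rw [pow_succ (7 / 8 : ℝ)]
      linarith
    · have h := h1 t ht
      rw [norm_sub_rev] at h
      have h2 := hcontract _ (h.trans hpow)
      simp only [Polynomial.eval_sub, Polynomial.eval_mul, Polynomial.eval_pow,
        Polynomial.eval_ofNat]
      have h3 : 3 * q.eval t ^ 2 - 2 * q.eval t ^ 3 - 1 =
          -(3 * (1 - q.eval t) ^ 2 - 2 * (1 - q.eval t) ^ 3) := by ring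
      rw [h3, norm_neg, pow_succ (7 / 8 : ℝ)]
      linarith

theorem exists_mvPolynomial_eval_eq_one_and_zero {n : ℕ} (S : Finset (Fin n → ℂ))
    (s : Fin n → ℂ) :
    ∃ L : MvPolynomial (Fin n) ℂ, MvPolynomial.eval s L = 1 ∧
      ∀ s' ∈ S, s' ≠ s → MvPolynomial.eval s' L = 0 := by
  classical
  have h : ∀ s' : Fin n → ℂ, ∃ L : MvPolynomial (Fin n) ℂ, MvPolynomial.eval s L = 1 ∧
      (s' ≠ s → MvPolynomial.eval s' L = 0) := by
    intro s'
    by_cases hs : s' = s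
    · exact ⟨1, by simp, fun h => absurd hs h⟩
    · obtain ⟨i, hi⟩ := Function.ne_iff.1 hs
      refine ⟨C (s i - s' i)⁻¹ * (X i - C (s' i)), ?_, fun _ => by simp⟩
      simp [sub_ne_zero.2 (Ne.symm hi)]
  choose L h1 h0 using h
  refine ⟨∏ s' ∈ S, L s', ?_, fun s' hs' hne => ?_⟩
  · rw [map_prod]
    exact Finset.prod_eq_one fun s' _ => h1 s'
  · rw [map_prod]
    exact Finset.prod_eq_zero hs' (h0 s' hne)

theorem exists_polynomial_approx_finset {n : ℕ} {f : (Fin n → ℂ) → ℂ} {U : Set (Fin n → ℂ)}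
    (hU : IsOpen U) (hf : DifferentiableOn ℂ f U) (S : Finset (Fin n → ℂ)) (hS : ↑S ⊆ U) :
    ∃ ρ > 0, (∀ s ∈ S, Metric.ball s ρ ⊆ U) ∧ ∀ ε > 0, ∃ P : MvPolynomial (Fin n) ℂ,
      ∀ s ∈ S, ∀ z ∈ Metric.ball s ρ, ‖MvPolynomial.eval z P - f z‖ ≤ ε := by
  choose L hL1 hL0 using exists_mvPolynomial_eval_eq_one_and_zero S
  have hloc : ∀ s ∈ S, ∀ᶠ ρ in nhdsWithin (0 : ℝ) (Set.Ioi 0), Metric.ball s ρ ⊆ U ∧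
      (∀ ε > 0, ∃ P : MvPolynomial (Fin n) ℂ,
        ∀ z ∈ Metric.ball s ρ, ‖MvPolynomial.eval z P - f z‖ ≤ ε) ∧
      ∀ s' ∈ S, ∀ z ∈ Metric.ball s ρ,
        ‖MvPolynomial.eval z (L s') - MvPolynomial.eval s (L s')‖ ≤ 1 / 4 := by
    intro s hs
    obtain ⟨ρ, hρ, hρU, happ⟩ := exists_polynomial_approx_ball hU hf (hS hs)
    have hnear : ∀ᶠ z in nhds s, ∀ s' ∈ S,
        ‖MvPolynomial.eval z (L s') - MvPolynomial.eval s (L s')‖ ≤ 1 / 4 := by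
      refine (Finset.eventually_all S).2 fun s' _ => ?_
      have hcont : Continuous fun z => ‖MvPolynomial.eval z (L s') - MvPolynomial.eval s (L s')‖ :=
        ((MvPolynomial.continuous_eval _).sub continuous_const).norm
      filter_upwards [hcont.continuousAt.eventually (gt_mem_nhds
        (show ‖MvPolynomial.eval s (L s') - MvPolynomial.eval s (L s')‖ < 1 / 4 by simp))]
        with z hz using hz.le
    obtain ⟨ρ', hρ', hball⟩ := Metric.eventually_nhds_iff_ball.1 hnear
    filter_upwards [Ioo_mem_nhdsGT (lt_min hρ hρ')] with r hr
    have hr1 : Metric.ball s r ⊆ Metric.ball s ρ :=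
      Metric.ball_subset_ball (hr.2.le.trans (min_le_left _ _))
    have hr2 : Metric.ball s r ⊆ Metric.ball s ρ' :=
      Metric.ball_subset_ball (hr.2.le.trans (min_le_right _ _))
    refine ⟨hr1.trans hρU, fun ε hε => ?_, fun s' hs' z hz => hball z (hr2 hz) s' hs'⟩
    obtain ⟨P, hP⟩ := happ ε hε
    exact ⟨P, fun z hz => hP z (hr1 hz)⟩
  obtain ⟨ρ, hall, hρ⟩ := (((Finset.eventually_all S).2 hloc).and self_mem_nhdsWithin).exists
  refine ⟨ρ, hρ, fun s hs => (hall s hs).1, fun ε hε => ?_⟩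
  have hcard : (0 : ℝ) < S.card + 1 := by positivity
  set η : ℝ := ε / (S.card + 1) with hη
  have hηpos : 0 < η := by positivity
  have hT : ∀ s, ∃ T : MvPolynomial (Fin n) ℂ, s ∈ S →
      ∀ z ∈ Metric.ball s ρ, ‖MvPolynomial.eval z T - f z‖ ≤ η := by
    intro s
    by_cases hs : s ∈ S
    · obtain ⟨T, hT⟩ := (hall s hs).2.1 η hηpos
      exact ⟨T, fun _ => hT⟩
    · exact ⟨0, fun h => absurd h hs⟩
  choose T hT using hT
  have hM : ∀ s, ∃ M > 0, ∀ s' ∈ S, ∀ z ∈ Metric.ball s' ρ, ‖MvPolynomial.eval z (T s)‖ ≤ M := by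
    intro s
    have hcomp : IsCompact (⋃ s' ∈ S, Metric.closedBall s' ρ) :=
      S.isCompact_biUnion fun s' _ => isCompact_closedBall s' ρ
    obtain ⟨M, hM⟩ := hcomp.exists_bound_of_continuousOn
      (MvPolynomial.continuous_eval (T s)).continuousOn
    refine ⟨max M 1, by positivity, fun s' hs' z hz => (hM z ?_).trans (le_max_left _ _)⟩
    exact Set.mem_biUnion hs' (Metric.ball_subset_closedBall hz)
  choose M hMpos hM using hM
  choose q hq0 hq1 using fun s => exists_polynomial_near_zero_near_one (div_pos hηpos (hMpos s))
  have heval : ∀ s z, MvPolynomial.eval z (Polynomial.aeval (L s) (q s)) =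
      (q s).eval (MvPolynomial.eval z (L s)) := fun s z => by
    have hid : (MvPolynomial.eval z).comp (algebraMap ℂ (MvPolynomial (Fin n) ℂ)) =
        RingHom.id ℂ := by
      ext
      simp
    rw [Polynomial.aeval_def, Polynomial.hom_eval₂, hid, Polynomial.eval₂_id]
  refine ⟨∑ s ∈ S, Polynomial.aeval (L s) (q s) * T s, fun s hs z hz => ?_⟩
  have hnear := (hall s hs).2.2
  have hterm : ∀ s' ∈ S, ‖MvPolynomial.eval z (Polynomial.aeval (L s') (q s') * T s') -
      (if s' = s then MvPolynomial.eval z (T s') else 0)‖ ≤ η := by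
    intro s' hs'
    have hL := hnear s' hs' z hz
    have hTM := hM s' s hs z hz
    have hcalc : ∀ c : ℂ, ‖c‖ ≤ η / M s' → ‖c * MvPolynomial.eval z (T s')‖ ≤ η := by
      intro c hc
      rw [norm_mul]
      have := hMpos s'
      calc _ ≤ η / M s' * M s' := by gcongr
        _ = η := by field_simp
    rw [map_mul, heval]
    split_ifs with h
    · subst h
      rw [hL1] at hL
      rw [← sub_one_mul]
      exact hcalc _ (hq1 _ _ hL)
    · rw [hL0 s' s hs (Ne.symm h), sub_zero] at hL
      rw [sub_zero]
      exact hcalc _ (hq0 _ _ hL)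
  have hsplit : MvPolynomial.eval z (∑ s' ∈ S, Polynomial.aeval (L s') (q s') * T s') - f z =
      ∑ s' ∈ S, (MvPolynomial.eval z (Polynomial.aeval (L s') (q s') * T s') -
        (if s' = s then MvPolynomial.eval z (T s') else 0)) +
      (MvPolynomial.eval z (T s) - f z) := by
    rw [Finset.sum_sub_distrib, Finset.sum_ite_eq' S s, if_pos hs, map_sum]
    ring
  rw [hsplit]
  calc _ ≤ S.card * η + η := by
        refine (norm_add_le _ _).trans (add_le_add ?_ (hT s hs z hz))
        refine (norm_sum_le_of_le S hterm).trans ?_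
        simp
    _ = ε := by
        rw [hη]
        field_simp

theorem continuous_gAct {n : ℕ} (σ : GL (Fin n) ℂ) : Continuous (gAct σ) :=
  Continuous.matrix_mulVec continuous_const continuous_id

theorem differentiable_gAct {n : ℕ} (σ : GL (Fin n) ℂ) : Differentiable ℂ (gAct σ) :=
  (Matrix.mulVecLin (σ : Matrix (Fin n) (Fin n) ℂ)).toContinuousLinearMap.differentiable

theorem gAct_one {n : ℕ} (z : Fin n → ℂ) : gAct 1 z = z := by
  simp [gAct]

theorem gAct_mul {n : ℕ} (σ τ : GL (Fin n) ℂ) (z : Fin n → ℂ) :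
    gAct (σ * τ) z = gAct σ (gAct τ z) := by
  simp [gAct, Matrix.mulVec_mulVec]

theorem eval_polyAct {n : ℕ} (σ : GL (Fin n) ℂ) (q : MvPolynomial (Fin n) ℂ) (z : Fin n → ℂ) :
    MvPolynomial.eval z (polyAct σ q) = MvPolynomial.eval (gAct σ⁻¹ z) q := by
  rw [polyAct, eval_aeval_eq]
  congr 2
  funext i
  simp [gAct, Matrix.mulVec, dotProduct]

theorem differentiable_mvPolynomial_eval {n : ℕ} (q : MvPolynomial (Fin n) ℂ) :
    Differentiable ℂ fun z => MvPolynomial.eval z q := by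
  induction q using MvPolynomial.induction_on with
  | C a => simp
  | add p q hp hq => simpa only [map_add] using hp.fun_add hq
  | mul_X p i hp => simpa only [map_mul, eval_X] using hp.fun_mul (differentiable_apply i)

theorem exists_line_eventually_eval_ne_zero {n : ℕ} {q : MvPolynomial (Fin n) ℂ} (hq : q ≠ 0)
    (w : Fin n → ℂ) :
    ∃ v : Fin n → ℂ, ∀ᶠ t in nhdsWithin (0 : ℂ) {0}ᶜ, MvPolynomial.eval (w + t • v) q ≠ 0 := by
  obtain ⟨u, hu⟩ : ∃ u, MvPolynomial.eval u q ≠ 0 := by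
    by_contra! h
    exact hq (MvPolynomial.funext fun x => by simpa using h x)
  refine ⟨u - w, ?_⟩
  have hd : Differentiable ℂ fun t : ℂ => MvPolynomial.eval (w + t • (u - w)) q :=
    (differentiable_mvPolynomial_eval q).comp (by fun_prop)
  by_contra h
  have hzero := AnalyticOnNhd.eqOn_zero_of_preconnected_of_frequently_eq_zero
    (fun t _ => hd.analyticAt t) isPreconnected_univ (Set.mem_univ 0)
    ((Filter.not_eventually.1 h).mono fun t ht => not_not.1 ht) (Set.mem_univ 1)
  exact hu (by simpa using hzero)

theorem dense_setOf_eval_ne_zero {n : ℕ} {q : MvPolynomial (Fin n) ℂ} (hq : q ≠ 0) :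
    Dense {z | MvPolynomial.eval z q ≠ 0} := by
  intro w
  obtain ⟨v, hv⟩ := exists_line_eventually_eval_ne_zero hq w
  have hcont : Continuous fun t : ℂ => w + t • v := by fun_prop
  refine mem_closure_of_tendsto (b := nhdsWithin (0 : ℂ) {0}ᶜ) (f := fun t : ℂ => w + t • v) ?_ hv
  exact (by simpa using hcont.tendsto 0 : Filter.Tendsto _ _ (nhds w)).mono_left nhdsWithin_le_nhds

/-- The square matrix whose rows are the translates of the tuple `p` by the elements of `G`. -/
def translateMatrix {n d : ℕ} {G : Subgroup (GL (Fin n) ℂ)} (e : Fin d ≃ G)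
    (p : Fin d → MvPolynomial (Fin n) ℂ) : Matrix (Fin d) (Fin d) (MvPolynomial (Fin n) ℂ) :=
  Matrix.of fun j i => polyAct (e j : GL (Fin n) ℂ)⁻¹ (p i)

theorem eval_translateMatrix {n d : ℕ} {G : Subgroup (GL (Fin n) ℂ)} (e : Fin d ≃ G)
    (p : Fin d → MvPolynomial (Fin n) ℂ) (z : Fin n → ℂ) (i j : Fin d) :
    MvPolynomial.eval z (translateMatrix e p j i) =
      MvPolynomial.eval (gAct (e j : GL (Fin n) ℂ) z) (p i) := by
  simp [translateMatrix, eval_polyAct]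

theorem det_translateMatrix_ne_zero {n d : ℕ} {G : Subgroup (GL (Fin n) ℂ)} (e : Fin d ≃ G)
    {p : Fin d → MvPolynomial (Fin n) ℂ}
    (hp : ∀ q : MvPolynomial (Fin n) ℂ, ∃ r : Fin d → MvPolynomial (Fin n) ℂ,
      (∀ i, ∀ σ ∈ G, polyAct σ (r i) = r i) ∧ q = ∑ i, r i * p i) :
    (translateMatrix e p).det ≠ 0 := by
  intro hdet
  obtain ⟨c, hc, hcM⟩ := Matrix.exists_vecMul_eq_zero_iff.2 hdet
  let χ : Fin d → (MvPolynomial (Fin n) ℂ →* MvPolynomial (Fin n) ℂ) := fun j =>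
    (MvPolynomial.aeval (R := ℂ) (fun i => ∑ k, C ((((e j : GL (Fin n) ℂ)⁻¹)⁻¹ :
      GL (Fin n) ℂ).1 i k) * X k : Fin n → MvPolynomial (Fin n) ℂ) :
      MvPolynomial (Fin n) ℂ →ₐ[ℂ] MvPolynomial (Fin n) ℂ)
  have hχ : ∀ j q, χ j q = polyAct (e j : GL (Fin n) ℂ)⁻¹ q := fun j q => rfl
  have hinj : Function.Injective χ := by
    intro j k hjk
    refine e.injective (Subtype.ext (Units.ext ?_))
    ext a b
    have h1 : polyAct (e j : GL (Fin n) ℂ)⁻¹ (X a) = polyAct (e k : GL (Fin n) ℂ)⁻¹ (X a) := by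
      rw [← hχ, ← hχ, hjk]
    have h2 := congrArg (MvPolynomial.eval (Pi.single b 1)) h1
    simpa [eval_polyAct, gAct] using h2
  have hind := (linearIndependent_monoidHom (MvPolynomial (Fin n) ℂ)
    (MvPolynomial (Fin n) ℂ)).comp χ hinj
  refine hc (funext fun j => Fintype.linearIndependent_iff.1 hind c ?_ j)
  funext q
  obtain ⟨r, hr, rfl⟩ := hp q
  have hrow : ∀ i, ∑ j, c j * χ j (p i) = 0 := fun i => congrFun hcM i
  have hχr : ∀ j, χ j (∑ i, r i * p i) = ∑ i, r i * χ j (p i) := by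
    intro j
    have : ∀ i, polyAct (e j : GL (Fin n) ℂ)⁻¹ (r i) = r i :=
      fun i => hr i _ (G.inv_mem (e j).2)
    rw [hχ, polyAct, map_sum]
    refine Finset.sum_congr rfl fun i _ => ?_
    rw [map_mul, ← polyAct, this]
    rfl
  simp only [Finset.sum_apply, Pi.smul_apply, Function.comp_apply, smul_eq_mul, Pi.zero_apply, hχr,
    Finset.mul_sum]
  rw [Finset.sum_comm]
  refine Finset.sum_eq_zero fun i _ => ?_
  rw [← mul_zero (r i), ← hrow i, Finset.mul_sum]
  exact Finset.sum_congr rfl fun j _ => by ring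

theorem eq_sum_adjugate_div_det {n d : ℕ} {M : Matrix (Fin d) (Fin d) (MvPolynomial (Fin n) ℂ)}
    {y : Fin n → ℂ} (hM : MvPolynomial.eval y M.det ≠ 0) {x b : Fin d → ℂ}
    (h : ∀ j, ∑ i, MvPolynomial.eval y (M j i) * x i = b j) (i : Fin d) :
    x i = ∑ j, MvPolynomial.eval y (M.adjugate i j) / MvPolynomial.eval y M.det * b j := by
  have hb : ((MvPolynomial.eval y).mapMatrix M).mulVec x = b := funext h
  have hadj : ((MvPolynomial.eval y).mapMatrix M.adjugate).mulVec b =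
      MvPolynomial.eval y M.det • x := by
    rw [← hb, Matrix.mulVec_mulVec, ← map_mul, Matrix.adjugate_mul, RingHom.mapMatrix_apply,
      Matrix.map_smul' _ _ _ (map_mul _), ← RingHom.mapMatrix_apply, map_one, Matrix.smul_mulVec,
      Matrix.one_mulVec]
  have hi : ∑ j, MvPolynomial.eval y (M.adjugate i j) * b j = MvPolynomial.eval y M.det * x i :=
    congrFun hadj i
  calc x i = (MvPolynomial.eval y M.det)⁻¹ * (MvPolynomial.eval y M.det * x i) := by
        rw [inv_mul_cancel_left₀ hM]
    _ = _ := by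
        rw [← hi, Finset.mul_sum]
        exact Finset.sum_congr rfl fun j _ => by ring

/-- The candidate coefficients of `f`, obtained from Cramer's rule where the determinant of the
matrix of translates does not vanish. -/
def cramerCoeff {n d : ℕ} {G : Subgroup (GL (Fin n) ℂ)} (e : Fin d ≃ G)
    (p : Fin d → MvPolynomial (Fin n) ℂ) (f : (Fin n → ℂ) → ℂ) (i : Fin d) (z : Fin n → ℂ) : ℂ :=
  ∑ j, MvPolynomial.eval z ((translateMatrix e p).adjugate i j) /
    MvPolynomial.eval z (translateMatrix e p).det * f (gAct (e j : GL (Fin n) ℂ) z)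

theorem eq_cramerCoeff {n d : ℕ} {G : Subgroup (GL (Fin n) ℂ)} (e : Fin d ≃ G)
    {p : Fin d → MvPolynomial (Fin n) ℂ} {f : (Fin n → ℂ) → ℂ} {z : Fin n → ℂ}
    (hz : MvPolynomial.eval z (translateMatrix e p).det ≠ 0) {x : Fin d → ℂ}
    (h : ∀ σ ∈ G, ∑ i, MvPolynomial.eval (gAct σ z) (p i) * x i = f (gAct σ z)) (i : Fin d) :
    x i = cramerCoeff e p f i z := by
  refine eq_sum_adjugate_div_det hz (fun j => ?_) i
  simp only [eval_translateMatrix]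
  exact h _ (e j).2

theorem eval_gAct_eq_sum {n d : ℕ} {G : Subgroup (GL (Fin n) ℂ)}
    {p r : Fin d → MvPolynomial (Fin n) ℂ} (hr : ∀ i, ∀ σ ∈ G, polyAct σ (r i) = r i)
    {σ : GL (Fin n) ℂ} (hσ : σ ∈ G) (z : Fin n → ℂ) :
    ∑ i, MvPolynomial.eval (gAct σ z) (p i) * MvPolynomial.eval z (r i) =
      MvPolynomial.eval (gAct σ z) (∑ i, r i * p i) := by
  rw [map_sum]
  refine Finset.sum_congr rfl fun i _ => ?_
  have h := eval_polyAct σ⁻¹ (r i) z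
  rw [hr i _ (G.inv_mem hσ), inv_inv] at h
  rw [map_mul, h, mul_comm]

theorem exists_local_solution {n d : ℕ} {G : Subgroup (GL (Fin n) ℂ)} (e : Fin d ≃ G)
    {p : Fin d → MvPolynomial (Fin n) ℂ}
    (hp : ∀ q : MvPolynomial (Fin n) ℂ, ∃ r : Fin d → MvPolynomial (Fin n) ℂ,
      (∀ i, ∀ σ ∈ G, polyAct σ (r i) = r i) ∧ q = ∑ i, r i * p i)
    {Ω : Set (Fin n → ℂ)} (hΩ : IsOpen Ω) {f : (Fin n → ℂ) → ℂ} (hf : DifferentiableOn ℂ f Ω)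
    {w : Fin n → ℂ} (hw : ∀ σ ∈ G, gAct σ w ∈ Ω) :
    ∃ V ∈ nhds w, ∃ h : Fin d → (Fin n → ℂ) → ℂ, (∀ i, DifferentiableOn ℂ (h i) V) ∧
      ∀ z ∈ V, ∀ σ ∈ G, ∑ i, MvPolynomial.eval (gAct σ z) (p i) * h i z = f (gAct σ z) := by
  classical
  set D := (translateMatrix e p).det
  have hD0 : D ≠ 0 := det_translateMatrix_ne_zero e hp
  obtain ⟨ρ, hρ, hρΩ, happ⟩ := exists_polynomial_approx_finset hΩ hf
    (Finset.univ.image fun j => gAct (e j : GL (Fin n) ℂ) w) (by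
      intro s hs
      obtain ⟨j, rfl⟩ := by simpa using hs
      exact hw _ (e j).2)
  set W : Set (Fin n → ℂ) :=
    ⋂ j, gAct (e j : GL (Fin n) ℂ) ⁻¹' Metric.ball (gAct (e j : GL (Fin n) ℂ) w) ρ
  have hWopen : IsOpen W :=
    isOpen_iInter_of_finite fun j => Metric.isOpen_ball.preimage (continuous_gAct _)
  have hwW : w ∈ W := Set.mem_iInter.2 fun j => Metric.mem_ball_self hρ
  have hWball : ∀ z ∈ W, ∀ j, gAct (e j : GL (Fin n) ℂ) z ∈
      Metric.ball (gAct (e j : GL (Fin n) ℂ) w) ρ := fun z hz j => Set.mem_iInter.1 hz j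
  have hWΩ : ∀ z ∈ W, ∀ j, gAct (e j : GL (Fin n) ℂ) z ∈ Ω := fun z hz j =>
    hρΩ _ (Finset.mem_image_of_mem _ (Finset.mem_univ j)) (hWball z hz j)
  set U : Set (Fin n → ℂ) := W ∩ {z | MvPolynomial.eval z D ≠ 0}
  have hUopen : IsOpen U :=
    hWopen.inter (isOpen_ne_fun (MvPolynomial.continuous_eval D) continuous_const)
  have hquot : ∀ i j, DifferentiableOn ℂ (fun z =>
      MvPolynomial.eval z ((translateMatrix e p).adjugate i j) / MvPolynomial.eval z D) U :=
    fun i j => by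
      simp only [div_eq_mul_inv]
      exact (differentiable_mvPolynomial_eval _).differentiableOn.fun_mul
        ((differentiable_mvPolynomial_eval D).differentiableOn.fun_inv fun z hz => hz.2)
  have hcoeff : ∀ g : (Fin n → ℂ) → ℂ, DifferentiableOn ℂ g Ω →
      ∀ i, DifferentiableOn ℂ (cramerCoeff e p g i) U := fun g hg i =>
    DifferentiableOn.fun_sum fun j _ => (hquot i j).fun_mul
      (hg.comp (differentiable_gAct _).differentiableOn fun z hz => hWΩ z hz.1 j)
  obtain ⟨v, hv⟩ := exists_line_eventually_eval_ne_zero hD0 w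
  have hline : Continuous fun q : (Fin n → ℂ) × ℂ => q.1 + q.2 • v := by fun_prop
  have hvW : ∀ᶠ t in nhds (0 : ℂ), w + t • v ∈ W := by
    have h : Continuous fun t : ℂ => w + t • v := by fun_prop
    exact h.continuousAt.eventually (hWopen.mem_nhds (by simpa using hwW))
  obtain ⟨R, hR, hball⟩ := Metric.eventually_nhds_iff_ball.1
    (hvW.and (eventually_nhdsWithin_iff.1 hv))
  set r := R / 2 with hr
  have hrpos : 0 < r := by positivity
  have hrball : Metric.closedBall (0 : ℂ) r ⊆ Metric.ball 0 R :=
    Metric.closedBall_subset_ball (by rw [hr]; linarith)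
  set V : Set (Fin n → ℂ) := {z | (∀ t ∈ Metric.closedBall (0 : ℂ) r, z + t • v ∈ W) ∧
    ∀ t ∈ Metric.sphere (0 : ℂ) r, z + t • v ∈ U}
  have hVnhds : V ∈ nhds w := by
    refine Filter.Eventually.and ?_ ?_
    · refine (isCompact_closedBall (0 : ℂ) r).eventually_forall_of_forall_eventually fun t ht => ?_
      exact hline.continuousAt.eventually (hWopen.mem_nhds (hball t (hrball ht)).1)
    · refine (isCompact_sphere (0 : ℂ) r).eventually_forall_of_forall_eventually fun t ht => ?_
      have ht' := hball t (hrball (Metric.sphere_subset_closedBall ht))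
      exact hline.continuousAt.eventually (hUopen.mem_nhds
        ⟨ht'.1, ht'.2 (Metric.ne_of_mem_sphere ht hrpos.ne')⟩)
  have hkernel : ContinuousOn (fun t : ℂ => (t - 0)⁻¹) (Metric.sphere 0 r) := by
    intro t ht
    have : t - 0 ≠ 0 := by simpa using Metric.ne_of_mem_sphere ht hrpos.ne'
    exact ContinuousAt.continuousWithinAt (by fun_prop (disch := assumption))
  refine ⟨V, hVnhds, fun i z => (2 * Real.pi * Complex.I)⁻¹ *
    ∮ t in C(0, r), (t - 0)⁻¹ * cramerCoeff e p f i (z + t • v), fun i z hz => ?_, ?_⟩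
  · exact ((differentiableAt_circleIntegral_mul_line hUopen (hcoeff f hf i) hrpos.le hkernel
      hz.2).const_mul _).differentiableWithinAt
  intro z hz σ hσ
  have hzW : z ∈ W := by simpa using hz.1 0 (Metric.mem_closedBall_self hrpos.le)
  have hseq : ∀ k : ℕ, ∃ s : Fin d → MvPolynomial (Fin n) ℂ,
      (∀ i, ∀ σ ∈ G, polyAct σ (s i) = s i) ∧ ∀ y ∈ W, ∀ j,
        ‖MvPolynomial.eval (gAct (e j : GL (Fin n) ℂ) y) (∑ i, s i * p i) -
          f (gAct (e j : GL (Fin n) ℂ) y)‖ ≤ 1 / ((k : ℝ) + 1) := by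
    intro k
    obtain ⟨P, hP⟩ := happ (1 / ((k : ℝ) + 1)) (by positivity)
    obtain ⟨s, hs, rfl⟩ := hp P
    exact ⟨s, hs, fun y hy j => hP _ (Finset.mem_image_of_mem _ (Finset.mem_univ j)) _
      (hWball y hy j)⟩
  choose s hs hsapp using hseq
  have hzero : Filter.Tendsto (fun k : ℕ => 1 / ((k : ℝ) + 1)) Filter.atTop (nhds 0) :=
    tendsto_one_div_add_atTop_nhds_zero_nat
  have hlim : ∀ i, Filter.Tendsto (fun k => MvPolynomial.eval z (s k i)) Filter.atTop
      (nhds ((2 * Real.pi * Complex.I)⁻¹ *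
        ∮ t in C(0, r), (t - 0)⁻¹ * cramerCoeff e p f i (z + t • v))) := by
    intro i
    have hmaps : Set.MapsTo (fun t : ℂ => z + t • v) (Metric.sphere 0 r) U := hz.2
    have hlinecont : ContinuousOn (fun t : ℂ => z + t • v) (Metric.sphere 0 r) := by fun_prop
    obtain ⟨B, hB⟩ := (isCompact_sphere (0 : ℂ) r).exists_bound_of_continuousOn
      (continuousOn_finsetSum Finset.univ fun j _ =>
        ((hquot i j).continuousOn.comp hlinecont hmaps).norm)
    have hcauchy : ∀ q : MvPolynomial (Fin n) ℂ, MvPolynomial.eval z q =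
        (2 * Real.pi * Complex.I)⁻¹ *
          ∮ t in C(0, r), (t - 0)⁻¹ * MvPolynomial.eval (z + t • v) q := by
      intro q
      have hd : Differentiable ℂ fun t : ℂ => MvPolynomial.eval (z + t • v) q :=
        (differentiable_mvPolynomial_eval q).comp (by fun_prop)
      have h := (hd.diffContOnCl (s := Metric.ball (0 : ℂ) r)
        ).two_pi_i_inv_smul_circleIntegral_sub_inv_smul (Metric.mem_ball_self hrpos)
      simp only [smul_eq_mul, zero_smul, add_zero] at h
      exact h.symm
    have hbound : Filter.Tendsto (fun k : ℕ => r * (r⁻¹ * B) * (1 / ((k : ℝ) + 1)))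
        Filter.atTop (nhds 0) := by
      simpa only [mul_zero] using hzero.const_mul (r * (r⁻¹ * B))
    rw [tendsto_iff_norm_sub_tendsto_zero]
    refine squeeze_zero (fun _ => norm_nonneg _) (fun k => ?_) hbound
    have hint1 : CircleIntegrable
        (fun t => (t - 0)⁻¹ * MvPolynomial.eval (z + t • v) (s k i)) 0 r := by
      refine ContinuousOn.circleIntegrable hrpos.le (hkernel.mul ?_)
      exact (MvPolynomial.continuous_eval _).comp_continuousOn hlinecont
    have hint2 : CircleIntegrable
        (fun t => (t - 0)⁻¹ * cramerCoeff e p f i (z + t • v)) 0 r :=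
      ContinuousOn.circleIntegrable hrpos.le (hkernel.mul
        ((hcoeff f hf i).continuousOn.comp hlinecont hmaps))
    rw [hcauchy (s k i), ← mul_sub, ← circleIntegral.integral_sub hint1 hint2, ← smul_eq_mul,
      mul_assoc r]
    refine circleIntegral.norm_two_pi_i_inv_smul_integral_le_of_norm_le_const hrpos.le
      fun t ht => ?_
    have htr : ‖t‖ = r := by simpa using ht
    have hBt := hB t ht
    rw [Real.norm_of_nonneg (Finset.sum_nonneg fun j _ => norm_nonneg _)] at hBt
    have hcr : MvPolynomial.eval (z + t • v) (s k i) = cramerCoeff e p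
        (fun y => MvPolynomial.eval y (∑ i, s k i * p i)) i (z + t • v) :=
      eq_cramerCoeff (x := fun i => MvPolynomial.eval (z + t • v) (s k i)) e (hmaps ht).2
        (fun σ hσ => eval_gAct_eq_sum (hs k) hσ _) i
    rw [← mul_sub, norm_mul, sub_zero, norm_inv, htr, mul_assoc, hcr]
    gcongr
    rw [cramerCoeff, cramerCoeff, ← Finset.sum_sub_distrib]
    refine (norm_sum_le _ _).trans (le_trans (Finset.sum_le_sum fun j _ => ?_)
      ((Finset.sum_mul _ _ _).symm.le.trans (mul_le_mul_of_nonneg_right hBt (by positivity))))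
    rw [← mul_sub, norm_mul]
    exact mul_le_mul_of_nonneg_left (hsapp k _ (hmaps ht).1 j) (norm_nonneg _)
  have hσe : gAct (e (e.symm ⟨σ, hσ⟩) : GL (Fin n) ℂ) = gAct σ := by simp
  have hlim1 : Filter.Tendsto
      (fun k => MvPolynomial.eval (gAct σ z) (∑ i, s k i * p i)) Filter.atTop
      (nhds (f (gAct σ z))) := by
    rw [tendsto_iff_norm_sub_tendsto_zero]
    refine squeeze_zero (fun _ => norm_nonneg _) (fun k => ?_) hzero
    simpa only [hσe] using hsapp k z hzW (e.symm ⟨σ, hσ⟩)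
  refine tendsto_nhds_unique (tendsto_finsetSum Finset.univ fun i _ => (hlim i).const_mul _)
    (hlim1.congr fun k => (eval_gAct_eq_sum (hs k) hσ z).symm)

theorem eqOn_of_forall_sum_eq {n d : ℕ} {G : Subgroup (GL (Fin n) ℂ)} (e : Fin d ≃ G)
    {p : Fin d → MvPolynomial (Fin n) ℂ} (hdet : (translateMatrix e p).det ≠ 0)
    {Ω : Set (Fin n → ℂ)} (hΩ : IsOpen Ω) {f : (Fin n → ℂ) → ℂ}
    {F F' : Fin d → (Fin n → ℂ) → ℂ} (hF : ∀ i, ContinuousOn (F i) Ω)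
    (hF' : ∀ i, ContinuousOn (F' i) Ω)
    (h : ∀ z ∈ Ω, ∀ σ ∈ G, ∑ i, MvPolynomial.eval (gAct σ z) (p i) * F i z = f (gAct σ z))
    (h' : ∀ z ∈ Ω, ∀ σ ∈ G, ∑ i, MvPolynomial.eval (gAct σ z) (p i) * F' i z = f (gAct σ z))
    (i : Fin d) : Set.EqOn (F i) (F' i) Ω := by
  refine Set.EqOn.of_subset_closure (fun z hz => ?_) (hF i) (hF' i) Set.inter_subset_left
    ((dense_setOf_eval_ne_zero hdet).open_subset_closure_inter hΩ)
  exact (eq_cramerCoeff (x := fun i => F i z) e hz.2 (h z hz.1) i).trans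
    (eq_cramerCoeff (x := fun i => F' i z) e hz.2 (h' z hz.1) i).symm

theorem exists_solution {n d : ℕ} {G : Subgroup (GL (Fin n) ℂ)} (e : Fin d ≃ G)
    {p : Fin d → MvPolynomial (Fin n) ℂ}
    (hp : ∀ q : MvPolynomial (Fin n) ℂ, ∃ r : Fin d → MvPolynomial (Fin n) ℂ,
      (∀ i, ∀ σ ∈ G, polyAct σ (r i) = r i) ∧ q = ∑ i, r i * p i)
    {Ω : Set (Fin n → ℂ)} (hΩ : IsOpen Ω) (hΩG : ∀ σ ∈ G, ∀ z ∈ Ω, gAct σ z ∈ Ω)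
    {f : (Fin n → ℂ) → ℂ} (hf : DifferentiableOn ℂ f Ω) :
    ∃ F : Fin d → (Fin n → ℂ) → ℂ, (∀ i, DifferentiableOn ℂ (F i) Ω) ∧
      ∀ z ∈ Ω, ∀ σ ∈ G, ∑ i, MvPolynomial.eval (gAct σ z) (p i) * F i z = f (gAct σ z) := by
  have hdense := dense_setOf_eval_ne_zero (det_translateMatrix_ne_zero e hp)
  set A : Set (Fin n → ℂ) := {z | MvPolynomial.eval z (translateMatrix e p).det ≠ 0}
  set F : Fin d → (Fin n → ℂ) → ℂ := fun i => extendFrom A (cramerCoeff e p f i)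
  have hloc : ∀ w ∈ Ω, ∃ V, IsOpen V ∧ w ∈ V ∧ (∀ i, DifferentiableOn ℂ (F i) V) ∧
      ∀ z ∈ V, ∀ σ ∈ G, ∑ i, MvPolynomial.eval (gAct σ z) (p i) * F i z = f (gAct σ z) := by
    intro w hw
    obtain ⟨V, hV, h, hdiff, hsol⟩ := exists_local_solution e hp hΩ hf fun σ hσ => hΩG σ hσ w hw
    have hFh : ∀ i, Set.EqOn (F i) (h i) (interior V) := by
      intro i z hz
      refine extendFrom_eq (hdense z) ?_
      have hcont : Filter.Tendsto (h i) (nhdsWithin z A) (nhds (h i z)) :=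
        ((hdiff i).differentiableAt (mem_interior_iff_mem_nhds.1 hz)).continuousAt.tendsto.mono_left
          nhdsWithin_le_nhds
      refine hcont.congr' ?_
      filter_upwards [self_mem_nhdsWithin,
        mem_nhdsWithin_of_mem_nhds (mem_interior_iff_mem_nhds.1 hz)] with y hyA hyV
      exact eq_cramerCoeff (x := fun i => h i y) e hyA (hsol y hyV) i
    refine ⟨interior V, isOpen_interior, mem_interior_iff_mem_nhds.2 hV, fun i =>
      ((hdiff i).mono interior_subset).congr (hFh i), fun z hz σ hσ => ?_⟩
    rw [← hsol z (interior_subset hz) σ hσ]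
    exact Finset.sum_congr rfl fun i _ => by rw [hFh i hz]
  refine ⟨F, fun i z hz => ?_, fun z hz => ?_⟩
  · obtain ⟨V, hV, hzV, hd, -⟩ := hloc z hz
    exact ((hd i).differentiableAt (hV.mem_nhds hzV)).differentiableWithinAt
  · obtain ⟨V, -, hzV, -, hs⟩ := hloc z hz
    exact hs z hzV

/-- **Analytic CST on `G`-invariant domains (free module form).**
For a finite pseudoreflection group `G`, a basis `p₁,…,p_d` of `ℂ[z]` over `ℂ[z]^G`
(`d = |G|`) and a `G`-invariant domain `Ω`, every holomorphic `f : Ω → ℂ` decomposes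
uniquely as `f = Σᵢ pᵢ fᵢ` on `Ω` with each `fᵢ` holomorphic and `G`-invariant on `Ω`;
i.e. `O(Ω)` is a free module of rank `|G|` over `O(Ω)^G` with basis `p₁,…,p_d`. -/
theorem analytic_CST_domain_free_module {n : ℕ} (G : Subgroup (GL (Fin n) ℂ)) [Finite G]
    (hG : IsPseudoreflectionGroup G) (d : ℕ) (hd : d = Nat.card G)
    (p : Fin d → MvPolynomial (Fin n) ℂ)
    (hbasis_ex : ∀ q : MvPolynomial (Fin n) ℂ, ∃ r : Fin d → MvPolynomial (Fin n) ℂ,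
      (∀ i, ∀ σ ∈ G, polyAct σ (r i) = r i) ∧ q = ∑ i, r i * p i)
    (hbasis_uniq : ∀ r r' : Fin d → MvPolynomial (Fin n) ℂ,
      (∀ i, ∀ σ ∈ G, polyAct σ (r i) = r i) → (∀ i, ∀ σ ∈ G, polyAct σ (r' i) = r' i) →
      ∑ i, r i * p i = ∑ i, r' i * p i → r = r')
    (Ω : Set (Fin n → ℂ)) (hΩopen : IsOpen Ω) (hΩconn : IsConnected Ω)
    (hΩinv : ∀ σ ∈ G, gAct σ '' Ω = Ω)
    (f : (Fin n → ℂ) → ℂ) (hf : DifferentiableOn ℂ f Ω) :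
    ∃ F : Fin d → (Fin n → ℂ) → ℂ,
      ((∀ i, DifferentiableOn ℂ (F i) Ω ∧ ∀ σ ∈ G, ∀ z ∈ Ω, F i (gAct σ z) = F i z) ∧
        ∀ z ∈ Ω, f z = ∑ i, MvPolynomial.eval z (p i) * F i z) ∧
      ∀ F' : Fin d → (Fin n → ℂ) → ℂ,
        (∀ i, DifferentiableOn ℂ (F' i) Ω ∧ ∀ σ ∈ G, ∀ z ∈ Ω, F' i (gAct σ z) = F' i z) →
        (∀ z ∈ Ω, f z = ∑ i, MvPolynomial.eval z (p i) * F' i z) →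
        ∀ i, Set.EqOn (F i) (F' i) Ω := by
  have e : Fin d ≃ G := (finCongr hd).trans (Finite.equivFin G).symm
  have hΩG : ∀ σ ∈ G, ∀ z ∈ Ω, gAct σ z ∈ Ω := fun σ hσ z hz =>
    hΩinv σ hσ ▸ Set.mem_image_of_mem _ hz
  obtain ⟨F, hFd, hF⟩ := exists_solution e hbasis_ex hΩopen hΩG hf
  have hdet := det_translateMatrix_ne_zero e hbasis_ex
  refine ⟨F, ⟨fun i => ⟨hFd i, fun τ hτ => ?_⟩, fun z hz => ?_⟩, fun F' hF' hfF' => ?_⟩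
  · refine eqOn_of_forall_sum_eq (F := fun i z => F i (gAct τ z)) e hdet hΩopen (fun i => ?_)
      (fun i => (hFd i).continuousOn) (fun z hz σ hσ => ?_) hF i
    · exact (hFd i).continuousOn.comp (continuous_gAct τ).continuousOn (hΩG τ hτ)
    · have h := hF _ (hΩG τ hτ z hz) (σ * τ⁻¹) (G.mul_mem hσ (G.inv_mem hτ))
      rwa [← gAct_mul, inv_mul_cancel_right] at h
  · simpa only [gAct_one] using (hF z hz 1 G.one_mem).symm
  · refine eqOn_of_forall_sum_eq e hdet hΩopen (fun i => (hFd i).continuousOn)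
      (fun i => (hF' i).1.continuousOn) hF fun z hz σ hσ => ?_
    rw [hfF' _ (hΩG σ hσ z hz)]
    exact Finset.sum_congr rfl fun i _ => by rw [(hF' i).2 σ hσ z hz]
end
end

section
/- Let ρ ∈ GL(n,ℂ) be a pseudoreflection with reflecting hyperplane H = ker(Iₙ − ρ), let L be a nonzero homogeneous linear polynomial with H = {z : L(z) = 0}, and let Ω ⊆ ℂⁿ be a domain with ρΩ = Ω. Then for every holomorphic function g : Ω → ℂ there exists a holomorphic function q : Ω → ℂ such that g(z) − g(ρ⁻¹z) = L(z)·q(z) for all z ∈ Ω; that is, L divides g − ρ·g in the ring of holomorphic functions on Ω. -/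
open MvPolynomial

noncomputable section

open Metric Set Filter Topology in
/-- A circle integral depending holomorphically on a parameter is holomorphic in the parameter. -/
theorem differentiableAt_circleIntegral_of_differentiableOn
    {E : Type*} [NormedAddCommGroup E] [NormedSpace ℂ E] [FiniteDimensional ℂ E]
    {W : Set (E × ℂ)} (hW : IsOpen W) {F : E × ℂ → ℂ} (hF : DifferentiableOn ℂ F W)
    {z₀ : E} {c : ℂ} {R : ℝ} (hR : 0 ≤ R) (hsub : ∀ w ∈ sphere c R, (z₀, w) ∈ W) :
    DifferentiableAt ℂ (fun z => ∮ w in C(c, R), F (z, w)) z₀ := by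
  have : ProperSpace E := FiniteDimensional.proper ℂ E
  have : ProperSpace (E →L[ℂ] ℂ) := FiniteDimensional.proper ℂ _
  borelize E
  obtain ⟨M, hM⟩ : ∃ M, ∀ p ∈ {z₀} ×ˢ sphere c R, ‖F p‖ ≤ M := by
    refine (isCompact_singleton.prod (isCompact_sphere c R)).exists_bound_of_continuousOn
      (hF.continuousOn.mono ?_)
    rintro ⟨z, w⟩ ⟨rfl, hw⟩
    exact hsub w hw
  have hopen : IsOpen (W ∩ F ⁻¹' ball 0 (M + 1)) :=
    hF.continuousOn.isOpen_inter_preimage hW isOpen_ball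
  obtain ⟨u, v, hu, -, hzu, hsv, huv⟩ := generalized_tube_lemma isCompact_singleton
    (isCompact_sphere c R) hopen (s := {z₀}) (by
      rintro ⟨z, w⟩ hp
      have hb := hM _ hp
      obtain ⟨rfl, hw⟩ := hp
      exact ⟨hsub w hw, by simpa using hb.trans_lt (lt_add_one M)⟩)
  obtain ⟨ε, hε, hεu⟩ := Metric.isOpen_iff.1 hu z₀ (hzu rfl)
  have hmem : ∀ x ∈ ball z₀ ε, ∀ θ : ℝ,
      (x, circleMap c R θ) ∈ W ∧ ‖F (x, circleMap c R θ)‖ < M + 1 := by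
    intro x hx θ
    have := huv (mk_mem_prod (hεu hx) (hsv (circleMap_mem_sphere c hR θ)))
    exact ⟨this.1, by simpa using this.2⟩
  have hcont : ∀ x ∈ ball z₀ ε, Continuous fun θ : ℝ =>
      deriv (circleMap c R) θ • F (x, circleMap c R θ) := by
    intro x hx
    simp only [deriv_circleMap]
    refine Continuous.fun_smul ((continuous_circleMap 0 R).mul continuous_const) ?_
    exact hF.continuousOn.comp_continuous (by fun_prop) fun θ => (hmem x hx θ).1
  have hderiv : ∀ x ∈ ball z₀ ε, ∀ θ : ℝ, HasFDerivAt (fun z => F (z, circleMap c R θ))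
      ((fderiv ℂ F (x, circleMap c R θ)).comp (ContinuousLinearMap.inl ℂ E ℂ)) x := by
    intro x hx θ
    exact (hF.differentiableAt (hW.mem_nhds (hmem x hx θ).1)).hasFDerivAt.comp x
      (hasFDerivAt_prodMk_left x _)
  refine (intervalIntegral.hasFDerivAt_integral_of_dominated_of_fderiv_le
    (F' := fun x θ => deriv (circleMap c R) θ •
      (fderiv ℂ F (x, circleMap c R θ)).comp (ContinuousLinearMap.inl ℂ E ℂ))
    (bound := fun _ => R * (2 * (M + 1) / (ε / 2)))
    (ball_mem_nhds z₀ (half_pos hε)) ?_ ?_ ?_ ?_ ?_ ?_).differentiableAt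
  · filter_upwards [ball_mem_nhds z₀ hε] with x hx
    exact (hcont x hx).aestronglyMeasurable
  · exact (hcont z₀ (mem_ball_self hε)).intervalIntegrable _ _
  · refine Measurable.aestronglyMeasurable ?_
    refine Measurable.fun_smul ?_ ?_
    · exact measurable_deriv _
    · have hcomp : Continuous fun T : E × ℂ →L[ℂ] ℂ =>
          T.comp (ContinuousLinearMap.inl ℂ E ℂ) := by fun_prop
      exact hcomp.measurable.comp ((measurable_fderiv ℂ F).comp
        (Continuous.measurable (by fun_prop)))
  · refine Eventually.of_forall fun θ _ x hx => ?_
    have hsubball : ball x (ε / 2) ⊆ ball z₀ ε := by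
      refine ball_subset_ball' ?_
      rw [mem_ball] at hx
      linarith
    have hxε : x ∈ ball z₀ ε := hsubball (mem_ball_self (half_pos hε))
    rw [norm_smul, deriv_circleMap, norm_mul, norm_circleMap_zero, Complex.norm_I, mul_one,
      abs_of_nonneg hR, ← (hderiv x hxε θ).fderiv]
    refine mul_le_mul_of_nonneg_left ?_ hR
    refine Complex.norm_fderiv_le_div_of_mapsTo_ball
      (fun y hy => (hderiv y (hsubball hy) θ).differentiableAt.differentiableWithinAt) ?_
      (half_pos hε)
    intro y hy
    rw [mem_closedBall, dist_eq_norm]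
    have h1 := (hmem y (hsubball hy) θ).2
    have h2 := (hmem x hxε θ).2
    linarith [norm_sub_le (F (y, circleMap c R θ)) (F (x, circleMap c R θ))]
  · exact intervalIntegrable_const
  · refine Eventually.of_forall fun θ _ x hx => ?_
    exact (hderiv x (ball_subset_ball (half_le_self hε.le) hx) θ).fun_const_smul _

open Metric Set Filter Topology in
/-- A holomorphic function vanishing on the kernel of a nonzero linear form is divisible by it. -/
theorem exists_differentiableOn_eq_mul_of_eqOn_ker
    {E : Type*} [NormedAddCommGroup E] [NormedSpace ℂ E] [FiniteDimensional ℂ E]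
    {Ω : Set E} (hΩ : IsOpen Ω) {h : E → ℂ} (hh : DifferentiableOn ℂ h Ω)
    {l : E →L[ℂ] ℂ} (hl : l ≠ 0) (hzero : ∀ z ∈ Ω, l z = 0 → h z = 0) :
    ∃ q : E → ℂ, DifferentiableOn ℂ q Ω ∧ ∀ z ∈ Ω, h z = l z * q z := by
  obtain ⟨v, hv⟩ : ∃ v, l v = 1 := by
    obtain ⟨u, hu⟩ := DFunLike.ne_iff.1 hl
    have hu' : l u ≠ 0 := by simpa using hu
    exact ⟨(l u)⁻¹ • u, by simp [hu']⟩
  refine ⟨fun z => if l z = 0 then deriv (fun w : ℂ => h (z + w • v)) 0 else h z / l z,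
    ?_, fun z hz => ?_⟩
  swap
  · by_cases hlz : l z = 0
    · simp [hlz, hzero z hz]
    · simp only [hlz, if_false]
      field_simp
  intro z₀ hz₀
  refine DifferentiableAt.differentiableWithinAt ?_
  by_cases hlz₀ : l z₀ = 0
  swap
  · have hev : ∀ᶠ z in 𝓝 z₀, l z ≠ 0 := l.continuous.continuousAt.eventually_ne hlz₀
    refine DifferentiableAt.congr_of_eventuallyEq (f := fun z => h z * (l z)⁻¹) ?_ ?_
    · exact (hh.differentiableAt (hΩ.mem_nhds hz₀)).mul
        (l.differentiableAt.inv hlz₀)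
    · filter_upwards [hev] with z hz
      simp [hz, div_eq_mul_inv]
  let Φ : E × ℂ → E := fun p => p.1 - l p.1 • v + p.2 • v
  have hΦd : Differentiable ℂ Φ := by fun_prop
  have hΦ₀ : Φ (z₀, 0) = z₀ := by simp [Φ, hlz₀]
  have hΦopen : IsOpen (Φ ⁻¹' Ω) := hΩ.preimage hΦd.continuous
  obtain ⟨δ, hδ, hball⟩ := Metric.isOpen_iff.1 hΦopen (z₀, 0) (by simpa [hΦ₀] using hz₀)
  have hmem : ∀ z ∈ ball z₀ δ, ∀ w ∈ ball (0 : ℂ) δ, Φ (z, w) ∈ Ω := fun z hz w hw =>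
    hball (by rw [← ball_prod_same]; exact ⟨hz, hw⟩)
  set r := δ / 2 with hr
  have hr0 : 0 < r := half_pos hδ
  have hrδ : r < δ := half_lt_self hδ
  let W : Set (E × ℂ) := Φ ⁻¹' Ω ∩ {p | p.2 ≠ 0} ∩ {p | p.2 - l p.1 ≠ 0}
  have hW : IsOpen W := (hΦopen.inter (isOpen_ne_fun (by fun_prop) (by fun_prop))).inter
    (isOpen_ne_fun (by fun_prop) (by fun_prop))
  let F : E × ℂ → ℂ := fun p => (p.2 - l p.1)⁻¹ • (p.2⁻¹ * h (Φ p))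
  have hF : DifferentiableOn ℂ F W := by
    rintro p ⟨⟨hp1, hp2⟩, hp3⟩
    refine DifferentiableAt.differentiableWithinAt ?_
    have d1 : DifferentiableAt ℂ (fun p => h (Φ p)) p :=
      (hh.differentiableAt (hΩ.mem_nhds hp1)).comp p hΦd.differentiableAt
    have d2 : DifferentiableAt ℂ (fun p : E × ℂ => (p.2 - l p.1)⁻¹) p :=
      DifferentiableAt.inv (by fun_prop) hp3
    have d3 : DifferentiableAt ℂ (fun p : E × ℂ => p.2⁻¹) p :=
      DifferentiableAt.inv (by fun_prop) hp2
    exact d2.smul (d3.mul d1)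
  have hdiff := (differentiableAt_circleIntegral_of_differentiableOn hW hF (z₀ := z₀) (c := 0)
    hr0.le fun w hw => by
      have hw0 : w ≠ 0 := ne_zero_of_mem_sphere hr0.ne' ⟨w, hw⟩
      refine ⟨⟨hmem z₀ (mem_ball_self hδ) w ?_, hw0⟩, by simpa [hlz₀] using hw0⟩
      exact sphere_subset_closedBall.trans (closedBall_subset_ball hrδ) hw).const_smul
      (2 * Real.pi * Complex.I : ℂ)⁻¹
  refine hdiff.congr_of_eventuallyEq ?_
  have hev : ∀ᶠ z in 𝓝 z₀, l z ∈ ball (0 : ℂ) r :=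
    l.continuous.continuousAt.eventually_mem (by simpa [hlz₀] using ball_mem_nhds (0 : ℂ) hr0)
  filter_upwards [hev, ball_mem_nhds z₀ hδ, hΩ.mem_nhds hz₀] with z hlz hz hzΩ
  let f : ℂ → ℂ := fun w => h (Φ (z, w))
  have hf : DifferentiableOn ℂ f (ball 0 δ) := fun w hw =>
    ((hh.differentiableAt (hΩ.mem_nhds (hmem z hz w hw))).comp w (by fun_prop :
      DifferentiableAt ℂ (fun w => Φ (z, w)) w)).differentiableWithinAt
  have hf0 : f 0 = 0 := hzero _ (hmem z hz 0 (mem_ball_self hδ)) (by simp [Φ, hv])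
  have hds : DifferentiableOn ℂ (dslope f 0) (closedBall 0 r) :=
    ((Complex.differentiableOn_dslope (ball_mem_nhds 0 hδ)).2 hf).mono
      (closedBall_subset_ball hrδ)
  have hint : (∮ w in C(0, r), F (z, w)) = ∮ w in C(0, r), (w - l z)⁻¹ • dslope f 0 w := by
    refine circleIntegral.integral_congr hr0.le fun w hw => ?_
    have hw0 : w ≠ 0 := ne_zero_of_mem_sphere hr0.ne' ⟨w, hw⟩
    simp [F, f, dslope_of_ne _ hw0, slope_def_field, hf0, div_eq_inv_mul] at hf0 ⊢
  have hpi : (2 * Real.pi * Complex.I : ℂ) ≠ 0 := Complex.two_pi_I_ne_zero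
  simp only [Pi.smul_apply, hint, hds.circleIntegral_sub_inv_smul hlz]
  rw [inv_smul_smul₀ hpi]
  by_cases hlz0 : l z = 0
  · simp [hlz0, f, Φ]
  · have hΦz : Φ (z, l z) = z := by simp [Φ]
    rw [if_neg hlz0, dslope_of_ne _ hlz0, slope_def_field, hf0]
    simp [f, hΦz]

theorem MvPolynomial.IsHomogeneous.exists_linearMap_eq_eval {σ R : Type*} [CommRing R]
    {p : MvPolynomial σ R} (hp : p.IsHomogeneous 1) :
    ∃ l : (σ → R) →ₗ[R] R, ∀ z, l z = MvPolynomial.eval z p := by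
  have hspan : p ∈ Submodule.span R (Set.range (MvPolynomial.X : σ → MvPolynomial σ R)) := by
    rw [← MvPolynomial.homogeneousSubmodule_one_eq_span_X]
    exact hp
  induction hspan using Submodule.span_induction with
  | mem x hx =>
    obtain ⟨i, rfl⟩ := hx
    exact ⟨LinearMap.proj i, by simp⟩
  | zero => exact ⟨0, by simp⟩
  | add x y hx hy ihx ihy =>
    rw [← MvPolynomial.homogeneousSubmodule_one_eq_span_X] at hx hy
    obtain ⟨lx, hlx⟩ := ihx hx
    obtain ⟨ly, hly⟩ := ihy hy
    exact ⟨lx + ly, by simp [hlx, hly]⟩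
  | smul a x hx ih =>
    rw [← MvPolynomial.homogeneousSubmodule_one_eq_span_X] at hx
    obtain ⟨l, hl⟩ := ih hx
    exact ⟨a • l, by simp [hl, MvPolynomial.smul_eval]⟩

theorem gAct_inv_gAct {n : ℕ} (σ : GL (Fin n) ℂ) (z : Fin n → ℂ) :
    gAct σ⁻¹ (gAct σ z) = z := by
  simp only [gAct, Matrix.mulVec_mulVec, ← Units.val_mul, inv_mul_cancel, Units.val_one,
    Matrix.one_mulVec]

/-- If `ρ` is a pseudoreflection with reflecting hyperplane `{L = 0}` and `Ω` is a
`ρ`-invariant domain, then for any holomorphic `g` on `Ω`, the linear form `L` divides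
`g − ρ·g` in the ring of holomorphic functions on `Ω`. -/
theorem linear_divides_g_sub_rho_g {n : ℕ} (ρ : GL (Fin n) ℂ) (hρ : IsPseudoreflection ρ)
    (L : MvPolynomial (Fin n) ℂ) (hL0 : L ≠ 0) (hLhom : L.IsHomogeneous 1)
    (hLker : {z : Fin n → ℂ | MvPolynomial.eval z L = 0} = {z : Fin n → ℂ | gAct ρ z = z})
    (Ω : Set (Fin n → ℂ)) (hΩopen : IsOpen Ω) (hΩconn : IsConnected Ω)
    (hΩinv : gAct ρ '' Ω = Ω)
    (g : (Fin n → ℂ) → ℂ) (hg : DifferentiableOn ℂ g Ω) :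
    ∃ q : (Fin n → ℂ) → ℂ, DifferentiableOn ℂ q Ω ∧
      ∀ z ∈ Ω, g z - g (gAct ρ⁻¹ z) = MvPolynomial.eval z L * q z := by
  obtain ⟨l, hl⟩ := hLhom.exists_linearMap_eq_eval
  have hl0 : l.toContinuousLinearMap ≠ 0 := by
    intro h
    refine hL0 (MvPolynomial.funext fun z => ?_)
    simpa [hl] using congrArg (fun T : (Fin n → ℂ) →L[ℂ] ℂ => T z) h
  have hmaps : Set.MapsTo (gAct ρ⁻¹) Ω Ω := by
    intro z hz
    rw [← hΩinv] at hz
    obtain ⟨y, hy, rfl⟩ := hz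
    rwa [gAct_inv_gAct]
  obtain ⟨q, hq, hdiv⟩ := exists_differentiableOn_eq_mul_of_eqOn_ker hΩopen
    (h := fun z => g z - g (gAct ρ⁻¹ z))
    (hg.sub (hg.comp (differentiable_gAct ρ⁻¹).differentiableOn hmaps)) hl0 (by
      intro z _ hz
      have hfix : gAct ρ z = z := by
        have hz' : z ∈ {z : Fin n → ℂ | MvPolynomial.eval z L = 0} := by simpa [hl] using hz
        rwa [hLker] at hz'
      have hfix' : gAct ρ⁻¹ z = z := by simpa [hfix] using gAct_inv_gAct ρ z
      simp [hfix'])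
  exact ⟨q, hq, fun z hz => by simpa [hl] using hdiv z hz⟩
end
end

section
/- Let G be a finite group, H a complex Hilbert space, U : G → B(H) a unitary representation, and π : G → U(m) an irreducible unitary matrix representation. Then for all 1 ≤ i,j ≤ m, the restriction of P_π^{ij} to the range of P_π^{jj} is a surjective isometry onto the range of P_π^{ii}: ‖P_π^{ij}(P_π^{jj}f)‖ = ‖P_π^{jj}f‖ for every f ∈ H, and P_π^{ij}(ran P_π^{jj}) = ran P_π^{ii}. -/
noncomputable section

/-- A unitary matrix representation is irreducible if the only subspaces of `ℂᵐ` invariant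
under all `π σ` are `{0}` and `ℂᵐ`. -/
def MatIrreducible {G : Type*} [Group G] {m : ℕ}
    (π : G →* Matrix.unitaryGroup (Fin m) ℂ) : Prop :=
  ∀ W : Submodule ℂ (Fin m → ℂ),
    (∀ σ : G, ∀ v ∈ W, Matrix.mulVec (π σ : Matrix (Fin m) (Fin m) ℂ) v ∈ W) →
    W = ⊥ ∨ W = ⊤

/-- Two matrix representations are equivalent if they are intertwined by an invertible
matrix. -/
def MatEquiv {G : Type*} [Group G] {m m' : ℕ}
    (π : G →* Matrix.unitaryGroup (Fin m) ℂ)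
    (π' : G →* Matrix.unitaryGroup (Fin m') ℂ) : Prop :=
  ∃ (A : Matrix (Fin m') (Fin m) ℂ) (B : Matrix (Fin m) (Fin m') ℂ),
    A * B = 1 ∧ B * A = 1 ∧
    ∀ σ : G, A * (π σ : Matrix (Fin m) (Fin m) ℂ) = (π' σ : Matrix (Fin m') (Fin m') ℂ) * A

/-- The operator `P_π^{ij} = (m/|G|)·Σ_{σ∈G} π(σ⁻¹)_{ji}·U(σ)`. -/
def Pij {G : Type*} [Group G] [Fintype G]
    {H : Type*} [NormedAddCommGroup H] [InnerProductSpace ℂ H]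
    (U : G →* (H →L[ℂ] H)) {m : ℕ} (π : G →* Matrix.unitaryGroup (Fin m) ℂ)
    (i j : Fin m) : H →L[ℂ] H :=
  ((m : ℂ) / (Fintype.card G : ℂ)) •
    ∑ σ : G, ((π σ⁻¹ : Matrix (Fin m) (Fin m) ℂ) j i) • U σ

/-- The operator `P_π = (m/|G|)·Σ_{σ∈G} χ_π(σ⁻¹)·U(σ)`, `χ_π = trace ∘ π`. -/
def Pproj {G : Type*} [Group G] [Fintype G]
    {H : Type*} [NormedAddCommGroup H] [InnerProductSpace ℂ H]
    (U : G →* (H →L[ℂ] H)) {m : ℕ} (π : G →* Matrix.unitaryGroup (Fin m) ℂ) :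
    H →L[ℂ] H :=
  ((m : ℂ) / (Fintype.card G : ℂ)) •
    ∑ σ : G, (Matrix.trace (π σ⁻¹ : Matrix (Fin m) (Fin m) ℂ)) • U σ


/-- Schur's lemma: a matrix commuting with an irreducible matrix representation is scalar. -/
theorem MatIrreducible.exists_eq_smul_one {G : Type*} [Group G] {m : ℕ} [NeZero m]
    {π : G →* Matrix.unitaryGroup (Fin m) ℂ} (hπ : MatIrreducible π)
    (M : Matrix (Fin m) (Fin m) ℂ)
    (hM : ∀ σ, (π σ : Matrix (Fin m) (Fin m) ℂ) * M = M * (π σ : Matrix (Fin m) (Fin m) ℂ)) :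
    ∃ c : ℂ, M = c • (1 : Matrix (Fin m) (Fin m) ℂ) := by
  obtain ⟨c, hc⟩ := Module.End.exists_eigenvalue (Matrix.toLin' M)
  refine ⟨c, ?_⟩
  have htop : Module.End.eigenspace (Matrix.toLin' M) c = ⊤ := by
    refine (hπ _ fun σ v hv => ?_).resolve_left hc
    rw [Module.End.mem_eigenspace_iff, Matrix.toLin'_apply] at hv ⊢
    rw [Matrix.mulVec_mulVec, ← hM, ← Matrix.mulVec_mulVec, hv, Matrix.mulVec_smul]
  refine Matrix.ext_of_mulVec_single fun k => ?_
  have hk : Pi.single k 1 ∈ Module.End.eigenspace (Matrix.toLin' M) c := htop ▸ trivial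
  rw [Module.End.mem_eigenspace_iff, Matrix.toLin'_apply] at hk
  rw [hk, Matrix.smul_mulVec, Matrix.one_mulVec]

/-- Schur orthogonality of the matrix coefficients of an irreducible matrix representation. -/
theorem MatIrreducible.sum_mul_inv {G : Type*} [Group G] [Fintype G] {m : ℕ}
    {π : G →* Matrix.unitaryGroup (Fin m) ℂ} (hπ : MatIrreducible π) (a i j k : Fin m) :
    (m : ℂ) / (Fintype.card G : ℂ) *
      ∑ τ : G, (π τ⁻¹ : Matrix (Fin m) (Fin m) ℂ) j i * (π τ : Matrix (Fin m) (Fin m) ℂ) a k =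
    if a = i ∧ j = k then 1 else 0 := by
  have : NeZero m := ⟨fun h => (h ▸ i : Fin 0).elim0⟩
  have hm : (m : ℂ) ≠ 0 := NeZero.ne _
  have hG : (Fintype.card G : ℂ) ≠ 0 := by simp
  have hmul (σ τ : G) : (π (σ * τ) : Matrix (Fin m) (Fin m) ℂ) = π σ * π τ := by simp
  set M : Matrix (Fin m) (Fin m) ℂ :=
    ∑ τ : G, (π τ : Matrix (Fin m) (Fin m) ℂ) * Matrix.single k j 1 *
      (π τ⁻¹ : Matrix (Fin m) (Fin m) ℂ) with hMdef
  obtain ⟨c, hc⟩ := hπ.exists_eq_smul_one M fun σ => by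
    rw [hMdef, Finset.mul_sum, Finset.sum_mul]
    refine Fintype.sum_equiv (Equiv.mulLeft σ) _ _ fun τ => ?_
    rw [Equiv.coe_mulLeft, hmul, Matrix.mul_assoc _ _ (π σ : Matrix (Fin m) (Fin m) ℂ), ← hmul]
    simp [Matrix.mul_assoc]
  have htrace : (Fintype.card G : ℂ) * (if j = k then 1 else 0) = c * m := by
    have h := congrArg Matrix.trace hc
    have hterm (τ : G) : Matrix.trace
        ((π τ : Matrix (Fin m) (Fin m) ℂ) * Matrix.single k j 1 *
      (π τ⁻¹ : Matrix (Fin m) (Fin m) ℂ)) =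
        if j = k then 1 else 0 := by
      rw [Matrix.trace_mul_comm, ← Matrix.mul_assoc, ← hmul, inv_mul_cancel]
      rcases eq_or_ne j k with rfl | h <;> simp [*, Ne.symm]
    rw [hMdef, Matrix.trace_sum] at h
    simp only [hterm] at h
    simpa using h
  have hentry : ∑ τ : G, (π τ⁻¹ : Matrix (Fin m) (Fin m) ℂ) j i *
      (π τ : Matrix (Fin m) (Fin m) ℂ) a k = if a = i then c else 0 := by
    have h := congrFun (congrFun hc a) i
    rw [hMdef, Matrix.sum_apply, Matrix.smul_apply, Matrix.one_apply, smul_eq_mul, mul_ite,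
      mul_one, mul_zero] at h
    rw [← h]
    refine Finset.sum_congr rfl fun τ _ => ?_
    rw [Matrix.mul_apply, Finset.sum_eq_single j]
    · simp [mul_comm]
    · intro b _ hb
      simp [Matrix.mul_single_apply_of_ne _ _ _ _ _ hb]
    · simp
  rw [hentry]
  by_cases ha : a = i <;> by_cases hj : j = k <;> simp [ha, hj] at htrace ⊢
  · field_simp
    rw [htrace, mul_comm]
  · exact Or.inr (htrace.resolve_right (NeZero.ne m))

section PijAlgebra

variable {G : Type*} [Group G] [Fintype G] {H : Type*} [NormedAddCommGroup H]
  [InnerProductSpace ℂ H] (U : G →* (H →L[ℂ] H)) {m : ℕ}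
  {π : G →* Matrix.unitaryGroup (Fin m) ℂ}

theorem mul_Pij (π : G →* Matrix.unitaryGroup (Fin m) ℂ) (τ : G) (k l : Fin m) :
    U τ * Pij U π k l = ∑ a, (π τ : Matrix (Fin m) (Fin m) ℂ) a k • Pij U π a l := by
  have hcoeff (σ : G) : (π σ⁻¹ : Matrix (Fin m) (Fin m) ℂ) l k =
      ∑ a, (π τ : Matrix (Fin m) (Fin m) ℂ) a k *
        (π (τ * σ)⁻¹ : Matrix (Fin m) (Fin m) ℂ) l a := by
    have h : σ⁻¹ = (τ * σ)⁻¹ * τ := by group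
    rw [h, map_mul, Matrix.UnitaryGroup.mul_val, Matrix.mul_apply]
    exact Finset.sum_congr rfl fun a _ => mul_comm _ _
  simp only [Pij, mul_smul_comm, smul_comm _ ((m : ℂ) / (Fintype.card G : ℂ)), ← Finset.smul_sum]
  congr 1
  simp only [Finset.mul_sum, Finset.smul_sum, mul_smul_comm, ← map_mul, smul_smul]
  rw [Finset.sum_comm]
  refine Fintype.sum_equiv (Equiv.mulLeft τ) _ _ fun σ => ?_
  rw [Equiv.coe_mulLeft, hcoeff, Finset.sum_smul]

theorem Pij_mul_Pij (hπ : MatIrreducible π) (i j k l : Fin m) :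
    Pij U π i j * Pij U π k l = if j = k then Pij U π i l else 0 := by
  have h : Pij U π i j * Pij U π k l =
      ∑ a, ((m : ℂ) / (Fintype.card G : ℂ) * ∑ τ : G, (π τ⁻¹ : Matrix (Fin m) (Fin m) ℂ) j i *
        (π τ : Matrix (Fin m) (Fin m) ℂ) a k) • Pij U π a l := by
    conv_lhs => rw [Pij.eq_def U π i j]
    simp only [smul_mul_assoc, Finset.sum_mul, mul_Pij, Finset.smul_sum, smul_smul,
      Finset.mul_sum, Finset.sum_smul]
    rw [Finset.sum_comm]
    simp only [mul_assoc]
  simp only [h, hπ.sum_mul_inv]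
  rw [Finset.sum_eq_single i] <;> simp +contextual

theorem adjoint_Pij [CompleteSpace H] (hU : ∀ σ : G, U σ ∈ unitary (H →L[ℂ] H))
    (π : G →* Matrix.unitaryGroup (Fin m) ℂ) (i j : Fin m) :
    star (Pij U π i j) = Pij U π j i := by
  have hstar (σ : G) : star (U σ) = U σ⁻¹ :=
    left_inv_eq_right_inv (Unitary.star_mul_self_of_mem (hU σ)) (by simp [← map_mul])
  simp only [Pij, star_smul, star_sum, hstar]
  congr 1
  · simp
  · refine Fintype.sum_equiv (Equiv.inv G) _ _ fun σ => ?_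
    simp [Matrix.star_apply]

end PijAlgebra

/-- The restriction of `P_π^{ij}` to `ran P_π^{jj}` is a surjective isometry onto
`ran P_π^{ii}`. -/
theorem Pij_unitary_between_ranges {G : Type*} [Group G] [Fintype G]
    {H : Type*} [NormedAddCommGroup H] [InnerProductSpace ℂ H] [CompleteSpace H]
    (U : G →* (H →L[ℂ] H)) (hU : ∀ σ : G, U σ ∈ unitary (H →L[ℂ] H))
    {m : ℕ} (π : G →* Matrix.unitaryGroup (Fin m) ℂ) (hπ : MatIrreducible π)
    (i j : Fin m) :
    (∀ f : H, ‖Pij U π i j (Pij U π j j f)‖ = ‖Pij U π j j f‖) ∧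
    Pij U π i j '' Set.range (Pij U π j j) = Set.range (Pij U π i i) := by
  have hmul (a b c : Fin m) (f : H) : Pij U π a b (Pij U π b c f) = Pij U π a c f := by
    simpa using DFunLike.congr_fun (Pij_mul_Pij U hπ a b b c) f
  refine ⟨fun f => ?_, ?_⟩
  · have h : inner ℂ (Pij U π i j (Pij U π j j f)) (Pij U π i j (Pij U π j j f)) =
        inner ℂ (Pij U π j j f) (Pij U π j j f) := by
      rw [← ContinuousLinearMap.adjoint_inner_right, ← ContinuousLinearMap.star_eq_adjoint,
        adjoint_Pij U hU, hmul, hmul]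
    rw [inner_self_eq_norm_sq_to_K, inner_self_eq_norm_sq_to_K] at h
    exact (sq_eq_sq₀ (norm_nonneg _) (norm_nonneg _)).mp (by exact_mod_cast h)
  · apply Set.Subset.antisymm
    · rintro _ ⟨_, ⟨f, rfl⟩, rfl⟩
      exact ⟨Pij U π i j f, by simp only [hmul]⟩
    · rintro _ ⟨f, rfl⟩
      exact ⟨_, ⟨Pij U π j i f, rfl⟩, by simp only [hmul]⟩
end
end
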